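/- Let R be a unital associative ℂ-algebra, M a left R-module, and f ∈ R such that δ_f is locally nilpotent on R (δ_f(b) = f*b − b*f) and the action of f on M is bijective with inverse F : M → M. For x ∈ ℂ define a ∗_x v := Σ_{j≥0} binom(x,j) (δ_f^j(a)) • F^j(v). Then for all x, y ∈ ℂ, a ∈ R and v ∈ M one has Σ_{k≥0} binom(y,k) (δ_f^k(a)) ∗_x F^k(v) = a ∗_{x+y} v; that is, the y-twist of the x-twisted action equals the (x+y)-twisted action (in particular the (−x)-twist of the x-twist is the original action). -/

import Mathlib

noncomputable section

/-- The inner derivation `δ_f b = f*b - b*f`. -/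
def innerDeriv {R : Type*} [Ring R] (f : R) : R → R := fun b => f * b - b * f

/-- The generalised binomial coefficient `binom(x, j) = x(x-1)⋯(x-j+1)/j!` for `x : ℂ`. -/
def cchoose (x : ℂ) (j : ℕ) : ℂ :=
  (∏ i ∈ Finset.range j, (x - i)) / (j.factorial : ℂ)

/-- Mathieu's `x`-twisted action of `a : R` on `v : M`:
`a ∗ₓ v = ∑_{j ≥ 0} binom(x, j) • (δ_f^[j] a) • F^[j] v`, a finite sum when `δ_f` is
locally nilpotent, where `F` is the inverse of the (bijective) action of `f` on `M`. -/
def twistedSMul {R M : Type*} [Ring R] [Algebra ℂ R] [AddCommGroup M] [Module R M]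
    (f : R) (F : M → M) (x : ℂ) (a : R) (v : M) : M :=
  ∑ᶠ j : ℕ, (algebraMap ℂ R (cchoose x j) * (innerDeriv f)^[j] a) • F^[j] v

open Finset in
theorem descPochhammer_smeval_eq_prod_range {R : Type*} [CommRing R] (x : R) (n : ℕ) :
    (descPochhammer ℤ n).smeval x = ∏ i ∈ range n, (x - i) := by
  induction n with
  | zero => simp
  | succ n ih =>
    rw [descPochhammer_succ_right, Polynomial.smeval_mul, ih, prod_range_succ]
    simp [Polynomial.smeval_sub, Polynomial.smeval_natCast]

theorem cchoose_eq_ringChoose (x : ℂ) (n : ℕ) : cchoose x n = Ring.choose x n := by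
  rw [Ring.choose_eq_smul, descPochhammer_smeval_eq_prod_range, cchoose, smul_eq_mul, mul_comm,
    div_eq_mul_inv]

/-- The Chu–Vandermonde convolution for complex binomial coefficients. -/
theorem cchoose_add (x y : ℂ) (n : ℕ) :
    cchoose (x + y) n = ∑ k ∈ Finset.range (n + 1), cchoose y k * cchoose x (n - k) := by
  simp only [cchoose_eq_ringChoose]
  rw [add_comm x y, Ring.add_choose_eq n (Commute.all y x),
    Finset.Nat.sum_antidiagonal_eq_sum_range_succ_mk]

theorem innerDeriv_zero {R : Type*} [Ring R] (f : R) : innerDeriv f 0 = 0 := by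
  simp [innerDeriv]

theorem iterate_innerDeriv_eq_zero_of_le {R : Type*} [Ring R] {f a : R} {m n : ℕ}
    (h : (innerDeriv f)^[m] a = 0) (hmn : m ≤ n) : (innerDeriv f)^[n] a = 0 := by
  rw [← Nat.sub_add_cancel hmn, Function.iterate_add_apply, h,
    Function.iterate_fixed (innerDeriv_zero f)]

theorem iterate_innerDeriv_algebraMap_mul {R : Type*} [Ring R] [Algebra ℂ R] (f : R) (c : ℂ)
    (n : ℕ) (a : R) :
    (innerDeriv f)^[n] (algebraMap ℂ R c * a) = algebraMap ℂ R c * (innerDeriv f)^[n] a := by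
  have h : Function.Semiconj (algebraMap ℂ R c * ·) (innerDeriv f) (innerDeriv f) := fun b => by
    simp only [innerDeriv]
    rw [mul_sub, ← mul_assoc, ← mul_assoc, ← mul_assoc, Algebra.commutes c f]
  exact ((h.iterate_right n).eq a).symm

theorem twistedSMul_eq_sum_range {R M : Type*} [Ring R] [Algebra ℂ R] [AddCommGroup M]
    [Module R M] {f : R} (F : M → M) (x : ℂ) {a : R} (v : M) {n : ℕ}
    (h : (innerDeriv f)^[n] a = 0) :
    twistedSMul f F x a v =
      ∑ j ∈ Finset.range n, (algebraMap ℂ R (cchoose x j) * (innerDeriv f)^[j] a) • F^[j] v := by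
  refine finsum_eq_sum_of_support_subset _ fun j hj => ?_
  by_contra hjn
  refine hj ?_
  simp [iterate_innerDeriv_eq_zero_of_le h (by simpa using hjn)]

/-- The `y`-twist of the `x`-twisted action equals the `(x+y)`-twisted
action: `∑_{k ≥ 0} binom(y,k) (δ_f^[k] a) ∗ₓ F^[k] v = a ∗_{x+y} v`. -/
theorem twisted_twisted_eq_twisted_add {R M : Type*} [Ring R] [Algebra ℂ R]
    [AddCommGroup M] [Module R M] (f : R) (F : M → M)
    (hnil : ∀ a : R, ∃ n : ℕ, (innerDeriv f)^[n] a = 0)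
    (hFl : ∀ v : M, F (f • v) = v) (hFr : ∀ v : M, f • F v = v)
    (x y : ℂ) (a : R) (v : M) :
    ∑ᶠ k : ℕ, twistedSMul f F x
        (algebraMap ℂ R (cchoose y k) * (innerDeriv f)^[k] a) (F^[k] v)
      = twistedSMul f F (x + y) a v := by
  obtain ⟨n, hn⟩ := hnil a
  have hinner (k : ℕ) :
      twistedSMul f F x (algebraMap ℂ R (cchoose y k) * (innerDeriv f)^[k] a) (F^[k] v) =
        ∑ j ∈ Finset.range (n - k),
          (algebraMap ℂ R (cchoose y k * cchoose x j) * (innerDeriv f)^[k + j] a) •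
            F^[k + j] v := by
    rw [twistedSMul_eq_sum_range F x (n := n - k)]
    · refine Finset.sum_congr rfl fun j _ => ?_
      rw [iterate_innerDeriv_algebraMap_mul, ← Function.iterate_add_apply,
        ← Function.iterate_add_apply, ← mul_assoc, ← map_mul, mul_comm (cchoose x j), add_comm j]
    · rw [iterate_innerDeriv_algebraMap_mul, ← Function.iterate_add_apply,
        iterate_innerDeriv_eq_zero_of_le hn (by omega), mul_zero]
  rw [finsum_congr hinner, twistedSMul_eq_sum_range F (x + y) v hn,
    finsum_eq_sum_of_support_subset (s := Finset.range n), ← Finset.sum_range_diag_flip]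
  · refine Finset.sum_congr rfl fun m _ => ?_
    rw [cchoose_add, map_sum, Finset.sum_mul, Finset.sum_smul]
    refine Finset.sum_congr rfl fun k hk => ?_
    rw [Nat.add_sub_cancel' (Finset.mem_range_succ_iff.mp hk)]
  · intro k hk
    by_contra hkn
    refine hk ?_
    have : n - k = 0 := Nat.sub_eq_zero_of_le (by simpa using hkn)
    simp [this]
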